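/- arXiv:math/0208002 — 5 statements merged into one kernel-verified Lean document; each statement's English description precedes it below -/
import Mathlib

section
/- The center of the group E is {I, −I}, where I is the identity map of V. -/
open Matrix BigOperators

/-- `U i = 𝔽₂^i`. -/
abbrev U (i : ℕ) := Fin i → ZMod 2

/-- Standard inner product on `𝔽₂^i`. -/
def dotp {i : ℕ} (a b : U i) : ZMod 2 := ∑ j, a j * b j

/-- The matrix of the map `X(a) : e_u ↦ e_{u+a}`. -/
def XM {i : ℕ} (a : U i) : Matrix (U i) (U i) ℝ :=
  fun w u => if w = u + a then 1 else 0

/-- The matrix of the map `Y(b) : e_u ↦ (−1)^{b·u} e_u`. -/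
def YM {i : ℕ} (b : U i) : Matrix (U i) (U i) ℝ :=
  Matrix.diagonal (fun u => (-1 : ℝ) ^ (dotp b u).val)

/-- The subgroup `E` of `GL(V)` generated by the `X(a)` and the `Y(b)`.
    We realize `GL(V)` as the group of units of the matrix ring. -/
def Egrp (i : ℕ) : Subgroup (Matrix (U i) (U i) ℝ)ˣ :=
  Subgroup.closure
    {g : (Matrix (U i) (U i) ℝ)ˣ |
      (∃ a : U i, (g : Matrix (U i) (U i) ℝ) = XM a) ∨
      (∃ b : U i, (g : Matrix (U i) (U i) ℝ) = YM b)}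

lemma U.add_self {i : ℕ} (a : U i) : a + a = 0 := by
  funext j
  exact CharTwo.add_self_eq_zero (a j)

lemma U.eq_add_iff {i : ℕ} (w u a : U i) : w = u + a ↔ u = w + a := by
  constructor <;> rintro rfl <;> rw [add_assoc, U.add_self, add_zero]

lemma XM_mul_apply {i : ℕ} (a : U i) (M : Matrix (U i) (U i) ℝ) (w u : U i) :
    (XM a * M) w u = M (w + a) u := by
  simp [Matrix.mul_apply, XM, U.eq_add_iff w]

lemma mul_XM_apply {i : ℕ} (a : U i) (M : Matrix (U i) (U i) ℝ) (w u : U i) :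
    (M * XM a) w u = M w (u + a) := by
  simp [Matrix.mul_apply, XM]

lemma XM_mul_self {i : ℕ} (a : U i) : XM a * XM a = 1 := by
  ext w u
  rw [XM_mul_apply]
  simp [XM, Matrix.one_apply]

lemma XM_transpose {i : ℕ} (a : U i) : (XM a)ᵀ = XM a := by
  ext w u
  simp only [Matrix.transpose_apply, XM, U.eq_add_iff u w a]

lemma YM_mul_self {i : ℕ} (b : U i) : YM b * YM b = 1 := by
  rw [YM, Matrix.diagonal_mul_diagonal, ← Matrix.diagonal_one]
  congr 1
  funext u
  rw [← mul_pow]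
  simp

lemma YM_transpose {i : ℕ} (b : U i) : (YM b)ᵀ = YM b :=
  Matrix.diagonal_transpose _

lemma dotp_single {i : ℕ} (j : Fin i) (u : U i) : dotp (Pi.single j 1) u = u j := by
  simp [dotp, Pi.single_apply]

lemma neg_one_pow_val_add_one (x : ZMod 2) :
    (-1 : ℝ) ^ (x + 1).val = -(-1 : ℝ) ^ x.val := by
  obtain rfl | rfl : x = 0 ∨ x = 1 := by decide +revert
  · simp [ZMod.val_one]
  · simp [ZMod.val_one, CharTwo.add_self_eq_zero]

lemma neg_one_pow_val_injective :
    Function.Injective fun x : ZMod 2 => (-1 : ℝ) ^ x.val := by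
  intro x y h
  obtain rfl | rfl : y = x ∨ y = x + 1 := by clear h; decide +revert
  · rfl
  · simp only [neg_one_pow_val_add_one, self_eq_neg] at h
    simp at h

/-- `X(a)` as an invertible matrix. -/
def XUnit {i : ℕ} (a : U i) : (Matrix (U i) (U i) ℝ)ˣ :=
  ⟨XM a, XM a, XM_mul_self a, XM_mul_self a⟩

/-- `Y(b)` as an invertible matrix. -/
def YUnit {i : ℕ} (b : U i) : (Matrix (U i) (U i) ℝ)ˣ :=
  ⟨YM b, YM b, YM_mul_self b, YM_mul_self b⟩

lemma XUnit_mem {i : ℕ} (a : U i) : XUnit a ∈ Egrp i :=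
  Subgroup.subset_closure (Or.inl ⟨a, rfl⟩)

lemma YUnit_mem {i : ℕ} (b : U i) : YUnit b ∈ Egrp i :=
  Subgroup.subset_closure (Or.inr ⟨b, rfl⟩)

lemma XM_mul_YM_single {i : ℕ} (j : Fin i) :
    XM (Pi.single j 1) * YM (Pi.single j 1) = -(YM (Pi.single j 1) * XM (Pi.single j 1)) := by
  ext w u
  rw [XM_mul_apply, Matrix.neg_apply, mul_XM_apply]
  simp only [YM, Matrix.diagonal_apply, dotp_single, U.eq_add_iff w u, eq_comm (b := u)]
  split_ifs
  · simp [neg_one_pow_val_add_one]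
  · simp

lemma neg_one_mem_Egrp {i : ℕ} (hi : 0 < i) : -1 ∈ Egrp i := by
  let a : U i := Pi.single ⟨0, hi⟩ 1
  have h : (-1 : (Matrix (U i) (U i) ℝ)ˣ) = XUnit a * YUnit a * (XUnit a * YUnit a) := by
    ext1
    have hXY : XM a * YM a = -(YM a * XM a) := XM_mul_YM_single _
    change (-1 : Matrix (U i) (U i) ℝ) = XM a * YM a * (XM a * YM a)
    nth_rewrite 1 [hXY]
    rw [neg_mul, mul_assoc, ← mul_assoc (XM a), XM_mul_self, one_mul, YM_mul_self]
  rw [h]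
  have hm := mul_mem (XUnit_mem a) (YUnit_mem a)
  exact mul_mem hm hm

lemma mul_transpose_of_mem_Egrp {i : ℕ} {g : (Matrix (U i) (U i) ℝ)ˣ} (hg : g ∈ Egrp i) :
    (g : Matrix (U i) (U i) ℝ) * (g : Matrix (U i) (U i) ℝ)ᵀ = 1 := by
  induction hg using Subgroup.closure_induction with
  | mem x hx =>
    rcases hx with ⟨a, ha⟩ | ⟨b, hb⟩
    · rw [ha, XM_transpose, XM_mul_self]
    · rw [hb, YM_transpose, YM_mul_self]
  | one => simp
  | mul x y _ _ hx hy =>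
    rw [Units.val_mul, Matrix.transpose_mul, mul_assoc,
      ← mul_assoc (y : Matrix (U i) (U i) ℝ), hy, one_mul, hx]
  | inv x _ hx =>
    have h : ((x⁻¹ : (Matrix (U i) (U i) ℝ)ˣ) : Matrix (U i) (U i) ℝ)
        = (x : Matrix (U i) (U i) ℝ)ᵀ := Units.inv_eq_of_mul_eq_one_right hx
    rw [h, Matrix.transpose_transpose]
    exact mul_eq_one_comm.mp hx

lemma eq_smul_one_of_commute {i : ℕ} {M : Matrix (U i) (U i) ℝ}
    (hX : ∀ a, M * XM a = XM a * M) (hY : ∀ b, M * YM b = YM b * M) :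
    M = M 0 0 • (1 : Matrix (U i) (U i) ℝ) := by
  ext w u
  rw [Matrix.smul_apply, Matrix.one_apply, smul_eq_mul, mul_ite, mul_one, mul_zero]
  split_ifs with h
  · subst h
    have := congrFun (congrFun (hX w) w) 0
    rwa [mul_XM_apply, XM_mul_apply, U.add_self, zero_add] at this
  · obtain ⟨j, hj⟩ := Function.ne_iff.mp h
    have := congrFun (congrFun (hY (Pi.single j 1)) w) u
    rw [YM, Matrix.mul_diagonal, Matrix.diagonal_mul, dotp_single, dotp_single,
      mul_comm] at this
    by_contra hM
    exact hj (neg_one_pow_val_injective (mul_right_cancel₀ hM this)).symm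

/-- the center of `E` is `{I, −I}`. -/
theorem stmt3 (i : ℕ) (hi : 0 < i) :
    {g : (Matrix (U i) (U i) ℝ)ˣ | g ∈ Egrp i ∧ ∀ h ∈ Egrp i, g * h = h * g}
      = {1, -1} := by
  ext g
  simp only [Set.mem_ofPred_eq, Set.mem_insert_iff, Set.mem_singleton_iff]
  constructor
  · rintro ⟨hg, hc⟩
    have hs := eq_smul_one_of_commute
      (fun a => congrArg Units.val (hc _ (XUnit_mem a)))
      (fun b => congrArg Units.val (hc _ (YUnit_mem b)))
    have ho := mul_transpose_of_mem_Egrp hg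
    generalize (g : Matrix (U i) (U i) ℝ) 0 0 = c at hs
    have hcc : c * c = 1 := by
      simpa [hs] using congrFun (congrFun ho 0) 0
    rcases mul_self_eq_one_iff.mp hcc with rfl | rfl
    · left
      ext1
      simpa using hs
    · right
      ext1
      simpa using hs
  · rintro (rfl | rfl)
    · exact ⟨one_mem _, fun h _ => by simp⟩
    · exact ⟨neg_one_mem_Egrp hi, fun h _ => by simp⟩
end

section
/- Let 0 ≤ k ≤ i − 1. For j = 1, 2 let S̄_j be a totally singular (i−k)-dimensional subspace of 𝔽₂^i × 𝔽₂^i, let S_j be its preimage in E, let χ_j : S_j → {1, −1} be a group homomorphism with χ_j(−I) = −1, and set Π_j = (1/|S_j|) Σ_{g∈S_j} χ_j(g)·g. If (S̄₁, χ₁) ≠ (S̄₂, χ₂), then the ranges P₁, P₂ of Π₁, Π₂ are distinct 2^k-dimensional subspaces of V and ½‖Π₁ − Π₂‖² ≥ 2^{k−1}, where ‖·‖ is the Frobenius norm; that is, the chordal distance between any two distinct planes of the packing is at least 2^{(k−1)/2}. -/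
open Matrix BigOperators

/-- The averaged operator `Π(S, χ) = (1/|S|) Σ_{g∈S} χ(g)·g`. -/
noncomputable def PiMat {i : ℕ} (S : Subgroup (Matrix (U i) (U i) ℝ)ˣ)
    (χ : S →* ℝˣ) : Matrix (U i) (U i) ℝ :=
  (Nat.card S : ℝ)⁻¹ • ∑ᶠ g : S, (χ g : ℝ) • ((g : (Matrix (U i) (U i) ℝ)ˣ) : Matrix (U i) (U i) ℝ)

/-- A subspace of `𝔽₂^i × 𝔽₂^i` is totally singular for `Q(a,b) = a·b` if
    `a·b = 0` for all its elements. -/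
def TotSing {i : ℕ} (S : Submodule (ZMod 2) (U i × U i)) : Prop :=
  ∀ p ∈ S, dotp p.1 p.2 = 0

/-- The preimage in `E` of a subspace `S̄ ⊆ 𝔽₂^i × 𝔽₂^i`, i.e. the subgroup
    `{ε·X(a)Y(b) : ε = ±1, (a,b) ∈ S̄}`. -/
def preim {i : ℕ} (S : Submodule (ZMod 2) (U i × U i)) :
    Subgroup (Matrix (U i) (U i) ℝ)ˣ :=
  Subgroup.closure
    {g : (Matrix (U i) (U i) ℝ)ˣ |
      ∃ a b : U i, (a, b) ∈ S ∧
        ((g : Matrix (U i) (U i) ℝ) = XM a * YM b ∨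
         (g : Matrix (U i) (U i) ℝ) = -(XM a * YM b))}

/-- The squared Frobenius norm of a real matrix. -/
def frobSq {n : Type*} [Fintype n] (A : Matrix n n ℝ) : ℝ :=
  ∑ u, ∑ v, (A u v) ^ 2

/-- The sign `(-1)^x` of an element of `𝔽₂`. -/
def sgn (x : ZMod 2) : ℝ := (-1) ^ x.val

theorem sgn_zero : sgn 0 = 1 := by simp [sgn]

theorem sgn_one : sgn 1 = -1 := by simp [sgn, ZMod.val_one]

theorem zmod_two_eq_zero_or_one (x : ZMod 2) : x = 0 ∨ x = 1 := by
  revert x; decide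

theorem sgn_add (x y : ZMod 2) : sgn (x + y) = sgn x * sgn y := by
  have h : (1 + 1 : ZMod 2) = 0 := by decide
  rcases zmod_two_eq_zero_or_one x with rfl | rfl <;>
    rcases zmod_two_eq_zero_or_one y with rfl | rfl <;> simp [sgn_zero, sgn_one, h]

theorem sgn_mul_self (x : ZMod 2) : sgn x * sgn x = 1 := by
  rcases zmod_two_eq_zero_or_one x with rfl | rfl <;> simp [sgn_zero, sgn_one]

theorem sgn_eq_or (x : ZMod 2) : sgn x = 1 ∨ sgn x = -1 := by
  rcases zmod_two_eq_zero_or_one x with rfl | rfl <;> simp [sgn_zero, sgn_one]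

section Weyl

variable {i : ℕ}

theorem dotp_add (b u v : U i) : dotp b (u + v) = dotp b u + dotp b v := by
  simp [dotp, mul_add, Finset.sum_add_distrib]

theorem add_dotp (b c u : U i) : dotp (b + c) u = dotp b u + dotp c u := by
  simp [dotp, add_mul, Finset.sum_add_distrib]

theorem dotp_comm (b u : U i) : dotp b u = dotp u b := by
  simp [dotp, mul_comm]

theorem sum_sgn_dotp (b : U i) : ∑ u, sgn (dotp b u) = if b = 0 then (2 : ℝ) ^ i else 0 := by
  split_ifs with h
  · simp [h, dotp, sgn_zero]
  · obtain ⟨j, hj⟩ := Function.ne_iff.mp h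
    have hj1 : b j = 1 := (zmod_two_eq_zero_or_one _).resolve_left hj
    have hs : dotp b (Pi.single j 1) = 1 := by simp [dotp, Pi.single_apply, hj1]
    have := Equiv.sum_comp (Equiv.addRight (Pi.single j 1 : U i)) (fun u => sgn (dotp b u))
    simp only [Equiv.coe_addRight, dotp_add, sgn_add, hs, sgn_one, mul_neg, mul_one,
      Finset.sum_neg_distrib] at this
    linarith

/-- The operator `X(a) Y(b)` for `p = (a, b)`. -/
def weyl (p : U i × U i) : Matrix (U i) (U i) ℝ := XM p.1 * YM p.2

theorem weyl_apply (p : U i × U i) (w u : U i) :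
    weyl p w u = if w = u + p.1 then sgn (dotp p.2 u) else 0 := by
  simp [weyl, YM, XM, sgn, Matrix.mul_diagonal]

theorem add_self_U (a : U i) : a + a = 0 := by
  ext j; exact CharTwo.add_self_eq_zero _

theorem weyl_mul (p q : U i × U i) :
    weyl p * weyl q = sgn (dotp p.2 q.1) • weyl (p + q) := by
  ext w u
  simp only [Matrix.mul_apply, weyl_apply, Matrix.smul_apply, smul_eq_mul, mul_ite, mul_zero,
    Finset.sum_ite_eq', Finset.mem_univ, if_true, Prod.fst_add, Prod.snd_add]
  rw [add_assoc, add_comm q.1]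
  split_ifs
  · rw [dotp_add, add_dotp, sgn_add, sgn_add]; ring
  · simp

theorem weyl_zero : weyl (0 : U i × U i) = 1 := by
  ext w u
  simp [weyl_apply, Matrix.one_apply, dotp, sgn_zero]

theorem prod_add_self (p : U i × U i) : p + p = 0 :=
  Prod.ext (add_self_U _) (add_self_U _)

theorem weyl_mul_self (p : U i × U i) : weyl p * weyl p = sgn (dotp p.2 p.1) • 1 := by
  rw [weyl_mul, prod_add_self, weyl_zero]

theorem weyl_transpose (p : U i × U i) : (weyl p)ᵀ = sgn (dotp p.1 p.2) • weyl p := by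
  ext w u
  simp only [Matrix.transpose_apply, weyl_apply, Matrix.smul_apply, smul_eq_mul, mul_ite, mul_zero]
  have h : u = w + p.1 ↔ w = u + p.1 := by
    constructor <;> rintro rfl <;> rw [add_assoc, add_self_U, add_zero]
  simp only [h]
  split_ifs with hw
  · rw [hw, dotp_add, sgn_add, dotp_comm p.2 p.1, mul_comm]
  · rfl

theorem sum_weyl_mul_weyl (p q : U i × U i) :
    ∑ w, ∑ u, weyl p w u * weyl q w u = if p = q then (2 : ℝ) ^ i else 0 := by
  rw [Finset.sum_comm]
  have h (u : U i) : ∑ w, weyl p w u * weyl q w u =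
      if p.1 = q.1 then sgn (dotp (p.2 + q.2) u) else 0 := by
    simp [weyl_apply, add_dotp, sgn_add, eq_comm (a := q.1)]
  have h2 : p.2 + q.2 = 0 ↔ p.2 = q.2 := by
    rw [add_eq_zero_iff_eq_neg, neg_eq_of_add_eq_zero_left (add_self_U q.2)]
  simp only [h, Prod.ext_iff]
  by_cases h1 : p.1 = q.1
  · simp [h1, sum_sgn_dotp, h2]
  · simp [h1]

theorem frobSq_sum_smul_weyl (d : U i × U i → ℝ) :
    frobSq (∑ p, d p • weyl p) = 2 ^ i * ∑ p, d p ^ 2 := by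
  calc frobSq (∑ p, d p • weyl p)
      = ∑ w, ∑ u, ∑ p, ∑ q, (d p * d q) * (weyl p w u * weyl q w u) := by
        simp only [frobSq, Matrix.sum_apply, Matrix.smul_apply, smul_eq_mul, sq,
          Finset.sum_mul_sum]
        refine Finset.sum_congr rfl fun w _ => Finset.sum_congr rfl fun u _ =>
          Finset.sum_congr rfl fun p _ => Finset.sum_congr rfl fun q _ => by ring
    _ = ∑ p, ∑ q, (d p * d q) * ∑ w, ∑ u, weyl p w u * weyl q w u := by
        simp only [Finset.mul_sum]
        rw [Finset.sum_congr rfl fun w _ => Finset.sum_comm, Finset.sum_comm]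
        refine Finset.sum_congr rfl fun p _ => ?_
        rw [Finset.sum_congr rfl fun w _ => Finset.sum_comm, Finset.sum_comm]
    _ = 2 ^ i * ∑ p, d p ^ 2 := by
        simp only [sum_weyl_mul_weyl, mul_ite, mul_zero, Finset.sum_ite_eq, Finset.mem_univ,
          if_true, Finset.mul_sum]
        exact Finset.sum_congr rfl fun p _ => by ring

theorem eq_of_weyl_eq_smul {p q : U i × U i} {c : ℝ} (hc : c ≠ 0)
    (h : weyl p = c • weyl q) : p = q := by
  by_contra hpq
  have h1 := sum_weyl_mul_weyl p q
  have h2 := sum_weyl_mul_weyl q q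
  simp only [h, Matrix.smul_apply, smul_eq_mul, mul_assoc, ← Finset.mul_sum, h2, if_true,
    if_neg hpq] at h1
  exact mul_ne_zero hc (by positivity) h1

/-- `X(a) Y(b)` as an invertible matrix. -/
def weylUnit (p : U i × U i) : (Matrix (U i) (U i) ℝ)ˣ where
  val := weyl p
  inv := sgn (dotp p.2 p.1) • weyl p
  val_inv := by rw [Matrix.mul_smul, weyl_mul_self, smul_smul, sgn_mul_self, one_smul]
  inv_val := by rw [Matrix.smul_mul, weyl_mul_self, smul_smul, sgn_mul_self, one_smul]

@[simp] theorem val_weylUnit (p : U i × U i) :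
    (weylUnit p : Matrix (U i) (U i) ℝ) = weyl p := rfl

theorem weylUnit_mul (p q : U i × U i) :
    weylUnit p * weylUnit q = weylUnit (p + q) ∨
      weylUnit p * weylUnit q = -weylUnit (p + q) := by
  rcases sgn_eq_or (dotp p.2 q.1) with h | h
  · left; ext1; simp [weyl_mul, h]
  · right; ext1; simp [weyl_mul, h]

theorem weylUnit_inv (p : U i × U i) :
    (weylUnit p)⁻¹ = weylUnit p ∨ (weylUnit p)⁻¹ = -weylUnit p := by
  have h0 : (↑(weylUnit p)⁻¹ : Matrix (U i) (U i) ℝ) = sgn (dotp p.2 p.1) • weyl p := rfl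
  rcases sgn_eq_or (dotp p.2 p.1) with h | h
  · left; ext1; simp [h0, h]
  · right; ext1; simp [h0, h]

variable {S : Submodule (ZMod 2) (U i × U i)}

theorem mem_preim_iff {g : (Matrix (U i) (U i) ℝ)ˣ} :
    g ∈ preim S ↔ ∃ p ∈ S, g = weylUnit p ∨ g = -weylUnit p := by
  constructor
  · intro hg
    induction hg using Subgroup.closure_induction with
    | mem x hx =>
      obtain ⟨a, b, hab, h⟩ := hx
      exact ⟨(a, b), hab, h.imp (fun h => Units.ext h) (fun h => Units.ext h)⟩
    | one => exact ⟨0, S.zero_mem, Or.inl (Units.ext weyl_zero.symm)⟩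
    | mul x y _ _ hx hy =>
      obtain ⟨p, hp, hx⟩ := hx
      obtain ⟨q, hq, hy⟩ := hy
      refine ⟨p + q, S.add_mem hp hq, ?_⟩
      rcases hx with rfl | rfl <;> rcases hy with rfl | rfl <;>
        rcases weylUnit_mul p q with h | h <;> simp [h]
    | inv x _ hx =>
      obtain ⟨p, hp, hx⟩ := hx
      refine ⟨p, hp, ?_⟩
      rcases hx with rfl | rfl <;> rcases weylUnit_inv p with h | h <;> simp [h]
  · rintro ⟨p, hp, h⟩
    exact Subgroup.subset_closure ⟨p.1, p.2, hp,
      h.imp (congrArg Units.val) (congrArg Units.val)⟩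

theorem weylUnit_mem {p : U i × U i} (hp : p ∈ S) : weylUnit p ∈ preim S :=
  mem_preim_iff.mpr ⟨p, hp, Or.inl rfl⟩

theorem neg_mem_preim {g : (Matrix (U i) (U i) ℝ)ˣ} (hg : g ∈ preim S) : -g ∈ preim S := by
  obtain ⟨p, hp, h⟩ := mem_preim_iff.mp hg
  refine mem_preim_iff.mpr ⟨p, hp, ?_⟩
  rcases h with rfl | rfl <;> simp

/-- The elements `± X(a) Y(b)` of the preimage of `S`, parametrized by `S` and a sign. -/
def signedWeyl (x : S × Bool) : preim S :=
  if x.2 then ⟨weylUnit x.1, weylUnit_mem x.1.2⟩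
  else ⟨-weylUnit x.1, neg_mem_preim (weylUnit_mem x.1.2)⟩

theorem signedWeyl_bijective : Function.Bijective (signedWeyl (S := S)) := by
  constructor
  · have key (p q : S) (h : weylUnit (p : U i × U i) = -weylUnit (q : U i × U i)) : False := by
      have h' : weyl (p : U i × U i) = (-1 : ℝ) • weyl (q : U i × U i) := by
        simpa using congrArg Units.val h
      rw [eq_of_weyl_eq_smul (by norm_num) h'] at h'
      have := sum_weyl_mul_weyl (q : U i × U i) q
      have h0 : weyl (q : U i × U i) = 0 := by
        ext w u
        have := congrFun (congrFun h' w) u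
        simp only [Matrix.smul_apply, smul_eq_mul, Matrix.zero_apply] at this ⊢
        linarith
      simp [h0, eq_comm (a := (0 : ℝ))] at this
    have inj (p q : S) (h : weylUnit (p : U i × U i) = weylUnit (q : U i × U i)) : p = q :=
      Subtype.ext (eq_of_weyl_eq_smul (c := 1) one_ne_zero
        (by simpa using congrArg Units.val h))
    rintro ⟨p, b⟩ ⟨q, c⟩ h
    cases b <;> cases c <;> simp only [signedWeyl, if_true, Subtype.mk.injEq, neg_inj,
      Bool.false_eq_true, if_false] at h
    · rw [inj p q h]
    · exact (key q p h.symm).elim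
    · exact (key p q h).elim
    · rw [inj p q h]
  · rintro ⟨g, hg⟩
    obtain ⟨p, hp, rfl | rfl⟩ := mem_preim_iff.mp hg
    · exact ⟨(⟨p, hp⟩, true), by simp [signedWeyl]⟩
    · exact ⟨(⟨p, hp⟩, false), by simp [signedWeyl]⟩

instance : Finite (preim S) := Finite.of_surjective _ signedWeyl_bijective.surjective

theorem PiMat_mul_self {G : Subgroup (Matrix (U i) (U i) ℝ)ˣ} [Finite G] {χ : G →* ℝˣ}
    (hval : ∀ s : G, (χ s : ℝ) = 1 ∨ (χ s : ℝ) = -1) :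
    PiMat G χ * PiMat G χ = PiMat G χ := by
  have := Fintype.ofFinite G
  have hcard : (Nat.card G : ℝ) ≠ 0 := Nat.cast_ne_zero.mpr Nat.card_pos.ne'
  have hg (g : G) :
      ((χ g : ℝ) • ((g : (Matrix (U i) (U i) ℝ)ˣ) : Matrix (U i) (U i) ℝ)) * PiMat G χ
        = PiMat G χ := by
    have hsq : (χ g : ℝ) * χ g = 1 := by rcases hval g with h | h <;> simp [h]
    simp only [PiMat, finsum_eq_sum_of_fintype, Matrix.mul_smul, Finset.mul_sum]
    congr 1
    refine Fintype.sum_equiv (Equiv.mulLeft g) _ _ fun h => ?_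
    simp [smul_smul, mul_comm]
  calc PiMat G χ * PiMat G χ
      = (Nat.card G : ℝ)⁻¹ • ∑ g : G,
          ((χ g : ℝ) • ((g : (Matrix (U i) (U i) ℝ)ˣ) : Matrix (U i) (U i) ℝ)) * PiMat G χ := by
        conv_lhs => enter [1]; rw [PiMat]
        rw [finsum_eq_sum_of_fintype, Matrix.smul_mul, Finset.sum_mul]
    _ = PiMat G χ := by
        simp only [hg, Finset.sum_const, Finset.card_univ, ← Nat.card_eq_fintype_card,
          ← Nat.cast_smul_eq_nsmul ℝ, smul_smul, inv_mul_cancel₀ hcard, one_smul]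

open Classical in
/-- The values of `χ` on the elements `X(a) Y(b)`, extended by zero outside `S`. -/
noncomputable def coef (χ : preim S →* ℝˣ) (p : U i × U i) : ℝ :=
  if h : p ∈ S then (χ ⟨weylUnit p, weylUnit_mem h⟩ : ℝ) else 0

theorem coef_of_mem (χ : preim S →* ℝˣ) {p : U i × U i} (h : p ∈ S) :
    coef χ p = χ ⟨weylUnit p, weylUnit_mem h⟩ := dif_pos h

theorem coef_of_notMem (χ : preim S →* ℝˣ) {p : U i × U i} (h : p ∉ S) : coef χ p = 0 :=
  dif_neg h

variable {χ : preim S →* ℝˣ}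

theorem map_neg_of_map_neg_one
    (hχ : ∀ m : preim S, ((m : (Matrix (U i) (U i) ℝ)ˣ) : Matrix (U i) (U i) ℝ) = -1 → χ m = -1)
    {g : (Matrix (U i) (U i) ℝ)ˣ} (hg : g ∈ preim S) :
    χ ⟨-g, neg_mem_preim hg⟩ = -χ ⟨g, hg⟩ := by
  have h1 : χ ⟨-1, neg_mem_preim (one_mem _)⟩ = -1 := hχ _ (by simp)
  rw [show (⟨-g, neg_mem_preim hg⟩ : preim S) =
    ⟨-1, neg_mem_preim (one_mem _)⟩ * ⟨g, hg⟩ from Subtype.ext (by simp), map_mul, h1, neg_one_mul]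

theorem coef_add
    (hχ : ∀ m : preim S, ((m : (Matrix (U i) (U i) ℝ)ˣ) : Matrix (U i) (U i) ℝ) = -1 → χ m = -1)
    {p q : U i × U i} (hp : p ∈ S) (hq : q ∈ S) :
    coef χ (p + q) = sgn (dotp p.2 q.1) * (coef χ p * coef χ q) := by
  rw [coef_of_mem χ hp, coef_of_mem χ hq, coef_of_mem χ (S.add_mem hp hq), ← Units.val_mul,
    ← map_mul]
  rcases sgn_eq_or (dotp p.2 q.1) with h | h
  · have e : weylUnit p * weylUnit q = weylUnit (p + q) := by ext1; simp [weyl_mul, h]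
    simp [h, e]
  · have e : weylUnit p * weylUnit q = -weylUnit (p + q) := by ext1; simp [weyl_mul, h]
    have := map_neg_of_map_neg_one hχ (weylUnit_mem (S.add_mem hp hq))
    simp only [MulMemClass.mk_mul_mk, e, this, h]
    simp

theorem PiMat_preim
    (hχ : ∀ m : preim S, ((m : (Matrix (U i) (U i) ℝ)ˣ) : Matrix (U i) (U i) ℝ) = -1 → χ m = -1) :
    PiMat (preim S) χ = ∑ p, ((Nat.card S : ℝ)⁻¹ * coef χ p) • weyl p := by
  classical
  have := Fintype.ofFinite (preim S)
  have hcard : Nat.card (preim S) = Nat.card S * 2 := by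
    rw [← Nat.card_congr (Equiv.ofBijective _ signedWeyl_bijective)]
    simp
  have hsum : ∑ g : preim S,
      (χ g : ℝ) • ((g : (Matrix (U i) (U i) ℝ)ˣ) : Matrix (U i) (U i) ℝ) =
      (2 : ℝ) • ∑ p, coef χ p • weyl p := by
    rw [← Equiv.sum_comp (Equiv.ofBijective _ signedWeyl_bijective), Fintype.sum_prod_type,
      ← Finset.sum_subset (Finset.subset_univ (Finset.univ.filter (· ∈ S)))
        (fun p _ hp => by rw [coef_of_notMem χ (by simpa using hp), zero_smul]),
      Finset.sum_subtype (p := (· ∈ S)) _ (by simp), Finset.smul_sum]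
    refine Finset.sum_congr rfl fun p _ => ?_
    have := map_neg_of_map_neg_one hχ (weylUnit_mem p.2)
    simp [signedWeyl, this, coef_of_mem χ p.2, two_smul]
  rw [PiMat, finsum_eq_sum_of_fintype, hsum, hcard, smul_smul, Finset.smul_sum]
  refine Finset.sum_congr rfl fun p _ => ?_
  rw [smul_smul]
  congr 1
  push_cast
  field_simp

theorem PiMat_preim_transpose (hts : TotSing S)
    (hχ : ∀ m : preim S, ((m : (Matrix (U i) (U i) ℝ)ˣ) : Matrix (U i) (U i) ℝ) = -1 → χ m = -1) :
    (PiMat (preim S) χ)ᵀ = PiMat (preim S) χ := by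
  rw [PiMat_preim hχ, Matrix.transpose_sum]
  refine Finset.sum_congr rfl fun p _ => ?_
  by_cases hp : p ∈ S
  · rw [Matrix.transpose_smul, weyl_transpose, hts p hp, sgn_zero, one_smul]
  · simp [coef_of_notMem χ hp]

theorem coef_eq_or (hval : ∀ s : preim S, (χ s : ℝ) = 1 ∨ (χ s : ℝ) = -1) {p : U i × U i}
    (hp : p ∈ S) : coef χ p = 1 ∨ coef χ p = -1 := by
  rw [coef_of_mem χ hp]; exact hval _

theorem frobSq_PiMat_preim
    (hval : ∀ s : preim S, (χ s : ℝ) = 1 ∨ (χ s : ℝ) = -1)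
    (hχ : ∀ m : preim S, ((m : (Matrix (U i) (U i) ℝ)ˣ) : Matrix (U i) (U i) ℝ) = -1 → χ m = -1) :
    frobSq (PiMat (preim S) χ) = 2 ^ i * (Nat.card S : ℝ)⁻¹ := by
  classical
  have hcard : (Nat.card S : ℝ) ≠ 0 := Nat.cast_ne_zero.mpr Nat.card_pos.ne'
  have h (p : U i × U i) : coef χ p ^ 2 = if p ∈ S then 1 else 0 := by
    split_ifs with hp
    · rcases coef_eq_or hval hp with h | h <;> simp [h]
    · simp [coef_of_notMem χ hp]
  rw [PiMat_preim hχ, frobSq_sum_smul_weyl]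
  simp only [mul_pow, ← Finset.mul_sum, h, Finset.sum_boole]
  rw [← Fintype.card_subtype, ← Nat.card_eq_fintype_card]
  change _ * (_ * (Nat.card S : ℝ)) = _
  field_simp

theorem card_eq_two_pow {d : ℕ} (hdim : Module.finrank (ZMod 2) S = d) : Nat.card S = 2 ^ d := by
  rw [Module.natCard_eq_pow_finrank (K := ZMod 2), hdim, Nat.card_zmod]

end Weyl

theorem frobSq_eq_trace {n : Type*} [Fintype n] (A : Matrix n n ℝ) :
    frobSq A = (A * Aᵀ).trace := by
  simp [frobSq, Matrix.trace, Matrix.mul_apply, sq]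

theorem finrank_range_toLin'_of_isIdempotentElem {n : Type*} [Fintype n] [DecidableEq n]
    {A : Matrix n n ℝ} (h : A * A = A) :
    (Module.finrank ℝ (LinearMap.range (Matrix.toLin' A)) : ℝ) = A.trace := by
  have hp : LinearMap.IsProj (LinearMap.range (Matrix.toLin' A)) (Matrix.toLin' A) := by
    refine ⟨fun x => ⟨x, rfl⟩, ?_⟩
    rintro _ ⟨x, rfl⟩
    rw [← LinearMap.comp_apply, ← Matrix.toLin'_mul, h]
  rw [← hp.trace, Matrix.trace_toLin'_eq]

/-- Symmetric idempotent matrices are determined by their range. -/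
theorem eq_of_range_toLin'_eq {n : Type*} [Fintype n] [DecidableEq n] {A B : Matrix n n ℝ}
    (hA : A * A = A) (hB : B * B = B) (hAt : Aᵀ = A) (hBt : Bᵀ = B)
    (h : LinearMap.range (Matrix.toLin' A) = LinearMap.range (Matrix.toLin' B)) : A = B := by
  have key {C D : Matrix n n ℝ} (hC : C * C = C)
      (hCD : LinearMap.range (Matrix.toLin' D) ≤ LinearMap.range (Matrix.toLin' C)) :
      C * D = D := by
    apply Matrix.toLin'.injective
    ext1 v
    obtain ⟨y, hy⟩ := hCD ⟨Pi.single v 1, rfl⟩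
    ext1
    simp only [LinearMap.comp_apply, Matrix.toLin'_mul, LinearMap.single_apply]
    rw [← hy, ← LinearMap.comp_apply, ← Matrix.toLin'_mul, hC]
  rw [← key hB h.le, ← hAt, ← hBt, ← Matrix.transpose_mul, key hA h.ge, hBt]

section Distance

variable {i : ℕ} {S₁ S₂ : Submodule (ZMod 2) (U i × U i)}
  {χ₁ : preim S₁ →* ℝˣ} {χ₂ : preim S₂ →* ℝˣ}

/-- The subspace of `S₁ ⊓ S₂` on which the two characters agree. -/
def agreement
    (hχ₁ : ∀ m : preim S₁, ((m : (Matrix (U i) (U i) ℝ)ˣ) : Matrix (U i) (U i) ℝ) = -1 → χ₁ m = -1)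
    (hχ₂ : ∀ m : preim S₂, ((m : (Matrix (U i) (U i) ℝ)ˣ) : Matrix (U i) (U i) ℝ) = -1 → χ₂ m = -1) :
    Submodule (ZMod 2) (U i × U i) :=
  AddSubgroup.toZModSubmodule 2
    { carrier := {p | p ∈ S₁ ∧ p ∈ S₂ ∧ coef χ₁ p = coef χ₂ p}
      zero_mem' := by
        have e : weylUnit (0 : U i × U i) = 1 := Units.ext weyl_zero
        refine ⟨S₁.zero_mem, S₂.zero_mem, ?_⟩
        rw [coef_of_mem _ S₁.zero_mem, coef_of_mem _ S₂.zero_mem]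
        rw [show (⟨weylUnit 0, weylUnit_mem S₁.zero_mem⟩ : preim S₁) = 1 from Subtype.ext e,
          show (⟨weylUnit 0, weylUnit_mem S₂.zero_mem⟩ : preim S₂) = 1 from Subtype.ext e,
          map_one, map_one]
      add_mem' := by
        rintro p q ⟨hp₁, hp₂, hp⟩ ⟨hq₁, hq₂, hq⟩
        exact ⟨S₁.add_mem hp₁ hq₁, S₂.add_mem hp₂ hq₂, by
          rw [coef_add hχ₁ hp₁ hq₁, coef_add hχ₂ hp₂ hq₂, hp, hq]⟩
      neg_mem' := by
        intro p hp
        rwa [neg_eq_of_add_eq_zero_left (prod_add_self p)] }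

theorem mem_agreement
    {hχ₁ : ∀ m : preim S₁, ((m : (Matrix (U i) (U i) ℝ)ˣ) : Matrix (U i) (U i) ℝ) = -1 → χ₁ m = -1}
    {hχ₂ : ∀ m : preim S₂, ((m : (Matrix (U i) (U i) ℝ)ˣ) : Matrix (U i) (U i) ℝ) = -1 → χ₂ m = -1}
    {p : U i × U i} :
    p ∈ agreement hχ₁ hχ₂ ↔ p ∈ S₁ ∧ p ∈ S₂ ∧ coef χ₁ p = coef χ₂ p := Iff.rfl

theorem not_le_agreement
    {hχ₁ : ∀ m : preim S₁, ((m : (Matrix (U i) (U i) ℝ)ˣ) : Matrix (U i) (U i) ℝ) = -1 → χ₁ m = -1}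
    {hχ₂ : ∀ m : preim S₂, ((m : (Matrix (U i) (U i) ℝ)ˣ) : Matrix (U i) (U i) ℝ) = -1 → χ₂ m = -1}
    (hne : S₁ ≠ S₂ ∨
      ∃ (g : (Matrix (U i) (U i) ℝ)ˣ) (h₁ : g ∈ preim S₁) (h₂ : g ∈ preim S₂),
        χ₁ ⟨g, h₁⟩ ≠ χ₂ ⟨g, h₂⟩)
    (hdim : Module.finrank (ZMod 2) S₁ = Module.finrank (ZMod 2) S₂) :
    ¬ S₁ ≤ agreement hχ₁ hχ₂ ∧ ¬ S₂ ≤ agreement hχ₁ hχ₂ := by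
  have key (hS : S₁ = S₂) (h : S₁ ≤ agreement hχ₁ hχ₂) : False := by
    refine hne.elim (· hS) ?_
    rintro ⟨g, h₁, h₂, hg⟩
    obtain ⟨p, hp, hgp⟩ := mem_preim_iff.mp h₁
    obtain ⟨hp₁, hp₂, hc⟩ := mem_agreement.mp (h hp)
    rw [coef_of_mem _ hp₁, coef_of_mem _ hp₂, Units.val_inj] at hc
    rcases hgp with rfl | rfl
    · exact hg hc
    · exact hg (by rw [map_neg_of_map_neg_one hχ₁ (weylUnit_mem hp₁),
        map_neg_of_map_neg_one hχ₂ (weylUnit_mem hp₂), hc])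
  refine ⟨fun h => ?_, fun h => ?_⟩
  · exact key (Submodule.eq_of_le_of_finrank_eq (fun p hp => (h hp).2.1) hdim) h
  · have hS := Submodule.eq_of_le_of_finrank_eq (fun p hp => (h hp).1) hdim.symm
    exact key hS.symm (hS ▸ h)

/-- A proper subspace omits at least half of the points of the ambient space. -/
theorem card_le_two_mul_card_sdiff {H S : Submodule (ZMod 2) (U i × U i)} (hle : H ≤ S)
    (hlt : ¬ S ≤ H) [DecidablePred (· ∈ S)] [DecidablePred (· ∈ H)] :
    Nat.card S ≤ 2 * (Finset.univ.filter fun p => p ∈ S ∧ p ∉ H).card := by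
  have hS : Nat.card S = (Finset.univ.filter (· ∈ S)).card := by
    rw [← Fintype.card_subtype, ← Nat.card_eq_fintype_card]
  have hH : Nat.card H = (Finset.univ.filter fun p => p ∈ S ∧ p ∈ H).card := by
    rw [← Fintype.card_subtype, ← Nat.card_eq_fintype_card]
    exact Nat.card_congr (Equiv.subtypeEquivRight fun p => ⟨fun h => ⟨hle h, h⟩, And.right⟩)
  have hsplit := Finset.card_filter_add_card_filter_not (s := Finset.univ.filter (· ∈ S)) (· ∈ H)
  rw [Finset.filter_filter, Finset.filter_filter, ← hS, ← hH] at hsplit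
  have hdvd : Nat.card H ∣ Nat.card S :=
    AddSubgroup.card_dvd_of_le (H := H.toAddSubgroup) (K := S.toAddSubgroup) hle
  have hne : Nat.card H ≠ Nat.card S := fun h => by
    have : H.toAddSubgroup = S.toAddSubgroup :=
      AddSubgroup.eq_of_le_of_card_ge hle h.ge
    exact hlt fun p hp => (this.ge hp : _)
  obtain ⟨m, hm⟩ := hdvd
  have hm2 : 2 ≤ m := by
    rcases m with _ | _ | m
    · exact absurd hm (by simp)
    · exact absurd (by rw [hm, zero_add, mul_one]) hne
    · omega
  have := Nat.mul_le_mul_left (Nat.card H) hm2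
  omega

theorem le_half_frobSq_PiMat_sub {N : ℕ} (hN₁ : Nat.card S₁ = N) (hN₂ : Nat.card S₂ = N)
    (hval₁ : ∀ s : preim S₁, (χ₁ s : ℝ) = 1 ∨ (χ₁ s : ℝ) = -1)
    (hval₂ : ∀ s : preim S₂, (χ₂ s : ℝ) = 1 ∨ (χ₂ s : ℝ) = -1)
    (hχ₁ : ∀ m : preim S₁, ((m : (Matrix (U i) (U i) ℝ)ˣ) : Matrix (U i) (U i) ℝ) = -1 → χ₁ m = -1)
    (hχ₂ : ∀ m : preim S₂, ((m : (Matrix (U i) (U i) ℝ)ˣ) : Matrix (U i) (U i) ℝ) = -1 → χ₂ m = -1)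
    (hne : ¬ S₁ ≤ agreement hχ₁ hχ₂ ∧ ¬ S₂ ≤ agreement hχ₁ hχ₂) :
    2 ^ i * (N : ℝ)⁻¹ ≤ frobSq (PiMat (preim S₁) χ₁ - PiMat (preim S₂) χ₂) := by
  classical
  set H := agreement hχ₁ hχ₂ with hH
  have hN : (0 : ℝ) < N := Nat.cast_pos.mpr (hN₁ ▸ Nat.card_pos)
  have h₁ := card_le_two_mul_card_sdiff (H := H) (S := S₁) (fun p hp => hp.1) hne.1
  have h₂ := card_le_two_mul_card_sdiff (H := H) (S := S₂) (fun p hp => hp.2.1) hne.2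
  rw [hN₁] at h₁
  rw [hN₂] at h₂
  have hpt (p : U i × U i) : (if p ∈ S₁ ∧ p ∉ H then (1 : ℝ) else 0) +
      (if p ∈ S₂ ∧ p ∉ H then (1 : ℝ) else 0) ≤ (coef χ₁ p - coef χ₂ p) ^ 2 := by
    by_cases hp : p ∈ H
    · simp only [hp, not_true, and_false, if_false, add_zero]; positivity
    by_cases hp₁ : p ∈ S₁ <;> by_cases hp₂ : p ∈ S₂
    · have hc : coef χ₁ p ≠ coef χ₂ p := fun h => hp ⟨hp₁, hp₂, h⟩
      rcases coef_eq_or hval₁ hp₁ with a | a <;> rcases coef_eq_or hval₂ hp₂ with b | b <;>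
        simp [hp₁, hp₂, hp, a, b] at hc ⊢ <;> norm_num
    · rcases coef_eq_or hval₁ hp₁ with a | a <;> simp [hp₁, hp₂, hp, a, coef_of_notMem χ₂ hp₂]
    · rcases coef_eq_or hval₂ hp₂ with b | b <;> simp [hp₁, hp₂, hp, b, coef_of_notMem χ₁ hp₁]
    · simp [hp₁, hp₂, coef_of_notMem χ₁ hp₁, coef_of_notMem χ₂ hp₂]
  have hsum : (N : ℝ) ≤ ∑ p, (coef χ₁ p - coef χ₂ p) ^ 2 := by
    refine le_trans ?_ (Finset.sum_le_sum fun p _ => hpt p)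
    rw [Finset.sum_add_distrib, Finset.sum_boole, Finset.sum_boole]
    norm_cast
    omega
  rw [PiMat_preim hχ₁, PiMat_preim hχ₂, hN₁, hN₂, ← Finset.sum_sub_distrib]
  simp only [← sub_smul, ← mul_sub]
  rw [frobSq_sum_smul_weyl]
  simp only [mul_pow, ← Finset.mul_sum]
  gcongr
  calc (N : ℝ)⁻¹ = (N : ℝ)⁻¹ ^ 2 * N := by field_simp
    _ ≤ _ := by gcongr

end Distance

theorem two_pow_mul_inv {i k : ℕ} (hk : k ≤ i) :
    (2 : ℝ) ^ i * ((2 ^ (i - k) : ℕ) : ℝ)⁻¹ = 2 ^ k := by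
  obtain ⟨d, rfl⟩ := Nat.exists_eq_add_of_le hk
  rw [Nat.add_sub_cancel_left, pow_add]
  push_cast
  field_simp

theorem finrank_range_PiMat_preim {i k : ℕ} (hk : k ≤ i) {S : Submodule (ZMod 2) (U i × U i)}
    {χ : preim S →* ℝˣ} (hdim : Module.finrank (ZMod 2) S = i - k) (hts : TotSing S)
    (hval : ∀ s : preim S, (χ s : ℝ) = 1 ∨ (χ s : ℝ) = -1)
    (hχ : ∀ m : preim S, ((m : (Matrix (U i) (U i) ℝ)ˣ) : Matrix (U i) (U i) ℝ) = -1 → χ m = -1) :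
    Module.finrank ℝ (LinearMap.range (Matrix.toLin' (PiMat (preim S) χ))) = 2 ^ k := by
  have h := finrank_range_toLin'_of_isIdempotentElem (PiMat_mul_self hval)
  have htr : (PiMat (preim S) χ).trace = frobSq (PiMat (preim S) χ) := by
    rw [frobSq_eq_trace, PiMat_preim_transpose hts hχ, PiMat_mul_self hval]
  rw [htr, frobSq_PiMat_preim hval hχ, card_eq_two_pow hdim, two_pow_mul_inv hk] at h
  exact_mod_cast h

/-- for two (subspace, character) pairs `(S̄₁,χ₁) ≠ (S̄₂,χ₂)` built from
    totally singular `(i−k)`-dimensional subspaces, the ranges `P₁, P₂` of the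
    projections `Π₁, Π₂` are distinct `2^k`-dimensional subspaces and
    `½‖Π₁ − Π₂‖² ≥ 2^{k−1}`. -/
theorem stmt10 (i k : ℕ) (hi : 0 < i) (hk : k ≤ i - 1)
    (S₁ S₂ : Submodule (ZMod 2) (U i × U i))
    (hdim₁ : Module.finrank (ZMod 2) S₁ = i - k)
    (hdim₂ : Module.finrank (ZMod 2) S₂ = i - k)
    (hts₁ : TotSing S₁) (hts₂ : TotSing S₂)
    (χ₁ : preim S₁ →* ℝˣ) (χ₂ : preim S₂ →* ℝˣ)
    (hval₁ : ∀ s : preim S₁, (χ₁ s : ℝ) = 1 ∨ (χ₁ s : ℝ) = -1)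
    (hval₂ : ∀ s : preim S₂, (χ₂ s : ℝ) = 1 ∨ (χ₂ s : ℝ) = -1)
    (hχ₁ : ∀ m : preim S₁, ((m : (Matrix (U i) (U i) ℝ)ˣ) : Matrix (U i) (U i) ℝ) = -1 → χ₁ m = -1)
    (hχ₂ : ∀ m : preim S₂, ((m : (Matrix (U i) (U i) ℝ)ˣ) : Matrix (U i) (U i) ℝ) = -1 → χ₂ m = -1)
    (hne : S₁ ≠ S₂ ∨
      ∃ (g : (Matrix (U i) (U i) ℝ)ˣ) (h₁ : g ∈ preim S₁) (h₂ : g ∈ preim S₂),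
        χ₁ ⟨g, h₁⟩ ≠ χ₂ ⟨g, h₂⟩) :
    LinearMap.range (Matrix.toLin' (PiMat (preim S₁) χ₁)) ≠
        LinearMap.range (Matrix.toLin' (PiMat (preim S₂) χ₂)) ∧
    Module.finrank ℝ (LinearMap.range (Matrix.toLin' (PiMat (preim S₁) χ₁))) = 2 ^ k ∧
    Module.finrank ℝ (LinearMap.range (Matrix.toLin' (PiMat (preim S₂) χ₂))) = 2 ^ k ∧
    (1 / 2 : ℝ) * frobSq (PiMat (preim S₁) χ₁ - PiMat (preim S₂) χ₂) ≥
      (2 : ℝ) ^ ((k : ℤ) - 1) := by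
  have hki : k ≤ i := hk.trans (Nat.sub_le i 1)
  have hdist : (2 : ℝ) ^ k ≤ frobSq (PiMat (preim S₁) χ₁ - PiMat (preim S₂) χ₂) := by
    have h := le_half_frobSq_PiMat_sub (card_eq_two_pow hdim₁) (card_eq_two_pow hdim₂) hval₁ hval₂
      hχ₁ hχ₂ (not_le_agreement hne (hdim₁.trans hdim₂.symm))
    rwa [two_pow_mul_inv hki] at h
  refine ⟨fun h => ?_, finrank_range_PiMat_preim hki hdim₁ hts₁ hval₁ hχ₁,
    finrank_range_PiMat_preim hki hdim₂ hts₂ hval₂ hχ₂, ?_⟩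
  · have hP := eq_of_range_toLin'_eq (PiMat_mul_self hval₁) (PiMat_mul_self hval₂)
      (PiMat_preim_transpose hts₁ hχ₁) (PiMat_preim_transpose hts₂ hχ₂) h
    rw [hP, sub_self] at hdist
    have : (0 : ℝ) < 2 ^ k := by positivity
    simp only [frobSq, Matrix.zero_apply] at hdist
    norm_num at hdist
    linarith
  · rw [zpow_sub_one₀ two_ne_zero, zpow_natCast]
    linarith
end

section
/- Let P₁, …, P_N (N ≥ 2) be pairwise distinct n-dimensional subspaces of ℝ^m. Then there exist indices r ≠ t such that ½‖Π_{P_r} − Π_{P_t}‖² ≤ (n(m−n)/m) · (N/(N−1)); that is, the minimal squared chordal distance of any packing of N planes in the Grassmannian G(m,n) is at most the simplex bound n(m−n)N/(m(N−1)). -/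
open Matrix BigOperators

/-- `M` is the matrix of the orthogonal projection of `ℝ^n` onto the subspace `P`:
    a symmetric idempotent matrix whose range is `P`. -/
def IsProjOnto {n : Type*} [Fintype n] [DecidableEq n]
    (M : Matrix n n ℝ) (P : Submodule ℝ (n → ℝ)) : Prop :=
  Mᵀ = M ∧ M * M = M ∧ LinearMap.range (Matrix.toLin' M) = P

theorem IsProjOnto.trace_eq_finrank {n : Type*} [Fintype n] [DecidableEq n]
    {M : Matrix n n ℝ} {P : Submodule ℝ (n → ℝ)} (h : IsProjOnto M P) :
    M.trace = Module.finrank ℝ P := by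
  obtain ⟨-, hidem, rfl⟩ := h
  have hlin : IsIdempotentElem (Matrix.toLin' M) := by
    rw [IsIdempotentElem, Module.End.mul_eq_comp, ← Matrix.toLin'_mul, hidem]
  rw [← Matrix.trace_toLin'_eq, (LinearMap.IsIdempotentElem.isProj_range _ hlin).trace]

theorem IsProjOnto.frobSq_eq_trace {n : Type*} [Fintype n] [DecidableEq n]
    {M : Matrix n n ℝ} {P : Submodule ℝ (n → ℝ)} (h : IsProjOnto M P) :
    frobSq M = M.trace := by
  obtain ⟨hsymm, hidem, -⟩ := h
  calc frobSq M = (M * Mᵀ).trace := by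
        simp [frobSq, Matrix.trace, Matrix.mul_apply, sq]
    _ = M.trace := by rw [hsymm, hidem]

theorem sq_trace_le_card_mul_frobSq {n : Type*} [Fintype n] (A : Matrix n n ℝ) :
    A.trace ^ 2 ≤ Fintype.card n * frobSq A := by
  have hdiag : ∑ u, A u u ^ 2 ≤ frobSq A :=
    Finset.sum_le_sum fun u _ =>
      Finset.single_le_sum (f := fun v => A u v ^ 2) (fun v _ => sq_nonneg _) (Finset.mem_univ u)
  calc A.trace ^ 2 ≤ Fintype.card n * ∑ u, A u u ^ 2 :=
        sq_sum_le_card_mul_sum_sq (s := Finset.univ) (f := fun u => A u u)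
    _ ≤ Fintype.card n * frobSq A := by gcongr

theorem sum_sum_sub_sq {ι : Type*} [Fintype ι] (a : ι → ℝ) :
    ∑ r, ∑ t, (a r - a t) ^ 2 = 2 * Fintype.card ι * ∑ r, a r ^ 2 - 2 * (∑ r, a r) ^ 2 := by
  simp only [sub_sq, Finset.sum_add_distrib, Finset.sum_sub_distrib, ← Finset.mul_sum,
    ← Finset.sum_mul, Finset.sum_const, Finset.card_univ, nsmul_eq_mul]
  ring

theorem frobSq_eq_sum_prod {n : Type*} [Fintype n] (A : Matrix n n ℝ) :
    frobSq A = ∑ p : n × n, A p.1 p.2 ^ 2 :=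
  (Fintype.sum_prod_type fun p : n × n => A p.1 p.2 ^ 2).symm

theorem sum_sum_frobSq_sub {ι n : Type*} [Fintype ι] [Fintype n] (A : ι → Matrix n n ℝ) :
    ∑ r, ∑ t, frobSq (A r - A t) =
      2 * Fintype.card ι * ∑ r, frobSq (A r) - 2 * frobSq (∑ r, A r) := by
  simp only [frobSq_eq_sum_prod, Matrix.sub_apply, Matrix.sum_apply]
  calc ∑ r, ∑ t, ∑ p : n × n, (A r p.1 p.2 - A t p.1 p.2) ^ 2
      = ∑ r, ∑ p : n × n, ∑ t, (A r p.1 p.2 - A t p.1 p.2) ^ 2 :=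
        Finset.sum_congr rfl fun _ _ => Finset.sum_comm
    _ = ∑ p : n × n, ∑ r, ∑ t, (A r p.1 p.2 - A t p.1 p.2) ^ 2 := Finset.sum_comm
    _ = 2 * Fintype.card ι * ∑ p : n × n, ∑ r, A r p.1 p.2 ^ 2
          - 2 * ∑ p : n × n, (∑ r, A r p.1 p.2) ^ 2 := by
        simp only [sum_sum_sub_sq, Finset.sum_sub_distrib, ← Finset.mul_sum]
    _ = _ := by rw [Finset.sum_comm]

/-- A function on ordered pairs that vanishes on the diagonal is at most its off-diagonal average
at some off-diagonal pair. -/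
theorem exists_ne_le_of_sum_sum_le {ι : Type*} [Fintype ι] [Nontrivial ι] (f : ι → ι → ℝ)
    (hdiag : ∀ r, f r r = 0) {B : ℝ}
    (hsum : ∑ r, ∑ t, f r t ≤ Fintype.card ι * ((Fintype.card ι - 1) * B)) :
    ∃ r t, r ≠ t ∧ f r t ≤ B := by
  classical
  by_contra! hlt
  refine hsum.not_gt ?_
  have hrow (r : ι) : ((Fintype.card ι : ℝ) - 1) * B < ∑ t, f r t := by
    obtain ⟨s, hs⟩ := exists_ne r
    calc ((Fintype.card ι : ℝ) - 1) * B = ∑ t ∈ Finset.univ.erase r, B := by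
          rw [Finset.sum_const, Finset.card_erase_of_mem (Finset.mem_univ r), Finset.card_univ,
            nsmul_eq_mul, Nat.cast_sub Fintype.card_pos, Nat.cast_one]
      _ < ∑ t ∈ Finset.univ.erase r, f r t :=
          Finset.sum_lt_sum_of_nonempty ⟨s, by simpa using hs⟩
            fun t ht => hlt r t (Finset.ne_of_mem_erase ht).symm
      _ = ∑ t, f r t := Finset.sum_erase _ (hdiag r)
  calc (Fintype.card ι : ℝ) * ((Fintype.card ι - 1) * B)
      = ∑ _r : ι, ((Fintype.card ι : ℝ) - 1) * B := by simp
    _ < ∑ r, ∑ t, f r t :=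
        Finset.sum_lt_sum_of_nonempty Finset.univ_nonempty fun r _ => hrow r

/-- simplex bound: among any `N ≥ 2` pairwise distinct `n`-dimensional
    subspaces of `ℝ^m`, some pair `P_r ≠ P_t` satisfies
    `½‖Π_{P_r} − Π_{P_t}‖² ≤ (n(m−n)/m)·(N/(N−1))`. -/
theorem stmt13 (m n N : ℕ) (hN : 2 ≤ N)
    (P : Fin N → Submodule ℝ (Fin m → ℝ))
    (hinj : Function.Injective P)
    (hdim : ∀ r, Module.finrank ℝ (P r) = n)
    (Proj : Fin N → Matrix (Fin m) (Fin m) ℝ)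
    (hproj : ∀ r, IsProjOnto (Proj r) (P r)) :
    ∃ r t, r ≠ t ∧
      (1 / 2 : ℝ) * frobSq (Proj r - Proj t) ≤
        ((n : ℝ) * ((m : ℝ) - (n : ℝ)) / (m : ℝ)) * ((N : ℝ) / ((N : ℝ) - 1)) := by
  have : Nontrivial (Fin N) := Fin.nontrivial_iff_two_le.mpr hN
  have hm : 0 < m := by
    rcases Nat.eq_zero_or_pos m with rfl | hm
    · obtain ⟨r, t, hrt⟩ := exists_pair_ne (Fin N)
      exact absurd (hinj (Subsingleton.elim (P r) (P t))) hrt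
    · exact hm
  have hm' : (0 : ℝ) < m := by exact_mod_cast hm
  have hN' : (0 : ℝ) < (N : ℝ) - 1 := by
    have : (2 : ℝ) ≤ N := by exact_mod_cast hN
    linarith
  have htr (r : Fin N) : (Proj r).trace = n := by
    rw [(hproj r).trace_eq_finrank, hdim]
  have hsq : ((N : ℝ) * n) ^ 2 ≤ m * frobSq (∑ r, Proj r) := by
    simpa [Matrix.trace_sum, htr] using sq_trace_le_card_mul_frobSq (∑ r, Proj r)
  have hsum : ∑ r, ∑ t, (1 / 2 : ℝ) * frobSq (Proj r - Proj t) =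
      N * (N * n) - frobSq (∑ r, Proj r) := by
    simp only [← Finset.mul_sum, sum_sum_frobSq_sub, (hproj _).frobSq_eq_trace, htr]
    simp only [Finset.sum_const, Finset.card_univ, Fintype.card_fin, nsmul_eq_mul]
    ring
  refine exists_ne_le_of_sum_sum_le (fun r t => (1 / 2 : ℝ) * frobSq (Proj r - Proj t))
    (fun r => by simp [frobSq]) ?_
  rw [hsum, Fintype.card_fin]
  calc (N : ℝ) * (N * n) - frobSq (∑ r, Proj r)
      ≤ N * (N * n) - ((N : ℝ) * n) ^ 2 / m :=
        sub_le_sub_left ((div_le_iff₀' hm').mpr hsq) _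
    _ = _ := by
        field_simp
end

section
/- For every integer i ≥ 2 there exists a set of exactly (2^i − 1)(2^i + 2) pairwise distinct subspaces of ℝ^{2^i}, each of dimension 2^{i−1}, such that any two distinct members P, Q satisfy ½‖Π_P − Π_Q‖² ≥ 2^{i−2}. Since (2^i − 1)(2^i + 2) = 2D where D = (2^i − 1)(2^i + 2)/2, and 2^{i−2} equals the orthoplex bound n(m−n)/m for m = 2^i, n = 2^{i−1}, this packing attains the orthoplex bound and is optimal. -/
open Matrix BigOperators

section Projections

variable {n : Type*} [Fintype n] [DecidableEq n]

/-- The matrix of the orthogonal projection onto a subspace is unique. -/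
lemma IsProjOnto.unique {M N : Matrix n n ℝ} {P : Submodule ℝ (n → ℝ)}
    (hM : IsProjOnto M P) (hN : IsProjOnto N P) : M = N := by
  have key : ∀ A B : Matrix n n ℝ, IsProjOnto A P → IsProjOnto B P → A * B = B := by
    intro A B hA hB
    apply Matrix.toLin'.injective
    ext1 v
    simp only [Matrix.toLin'_mul]
    have hv : Matrix.toLin' B (Pi.single v 1) ∈ LinearMap.range (Matrix.toLin' A) := by
      rw [hA.2.2, ← hB.2.2]
      exact LinearMap.mem_range_self _ _
    obtain ⟨w, hw⟩ := hv
    ext1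
    simp only [LinearMap.comp_apply, LinearMap.single_apply, ← hw]
    rw [← LinearMap.comp_apply, ← Matrix.toLin'_mul, hA.2.1]
  have h := congrArg Matrix.transpose (key N M hN hM)
  rw [Matrix.transpose_mul, hM.1, hN.1, key M N hM hN] at h
  exact h.symm

lemma finrank_range_toLin'_of_isIdempotent {M : Matrix n n ℝ} (h : M * M = M) :
    (Module.finrank ℝ (LinearMap.range (Matrix.toLin' M)) : ℝ) = M.trace := by
  have hp : IsIdempotentElem (Matrix.toLin' M) := by
    rw [IsIdempotentElem, Module.End.mul_eq_comp, ← Matrix.toLin'_mul, h]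
  rw [← (LinearMap.IsIdempotentElem.isProj_range _ hp).trace, Matrix.trace_toLin'_eq]

omit [DecidableEq n] in
lemma frobSq_submatrix_equiv {k : Type*} [Fintype k] (A : Matrix n n ℝ) (e : k ≃ n) :
    frobSq (A.submatrix e e) = frobSq A := by
  simp only [frobSq, Matrix.submatrix_apply]
  rw [e.sum_comp (fun u => ∑ v, A u (e v) ^ 2)]
  exact Finset.sum_congr rfl fun u _ => e.sum_comp (fun v => A u v ^ 2)

/-- A family of symmetric idempotent matrices of trace `r` whose squared chordal distances are
at least `c > 0` gives a packing of distinct `r`-dimensional subspaces. -/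
lemma exists_packing_of_projections {J : Type*} [Fintype J] (M : J → Matrix n n ℝ) (r : ℕ) (c : ℝ)
    (hc : 0 < c) (hT : ∀ j, (M j)ᵀ = M j) (hI : ∀ j, M j * M j = M j)
    (htr : ∀ j, (M j).trace = r)
    (hd : ∀ j k, j ≠ k → c ≤ (1 / 2 : ℝ) * frobSq (M j - M k)) :
    ∃ Pk : Finset (Submodule ℝ (n → ℝ)),
      Pk.card = Fintype.card J ∧
      (∀ P ∈ Pk, Module.finrank ℝ P = r) ∧
      (∀ P ∈ Pk, ∀ Q ∈ Pk, P ≠ Q → ∀ MP MQ : Matrix n n ℝ,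
        IsProjOnto MP P → IsProjOnto MQ Q → (1 / 2 : ℝ) * frobSq (MP - MQ) ≥ c) := by
  classical
  have hP : ∀ j, IsProjOnto (M j) (LinearMap.range (Matrix.toLin' (M j))) :=
    fun j => ⟨hT j, hI j, rfl⟩
  have hinj : Function.Injective fun j => LinearMap.range (Matrix.toLin' (M j)) := by
    intro j k hjk
    by_contra hne
    have hjk : LinearMap.range (Matrix.toLin' (M j)) = LinearMap.range (Matrix.toLin' (M k)) := hjk
    have hM : M j = M k := (hP j).unique (hjk ▸ hP k)
    have := hd j k hne
    simp only [hM, sub_self, frobSq, Matrix.zero_apply] at this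
    norm_num at this
    linarith
  refine ⟨Finset.univ.image fun j => LinearMap.range (Matrix.toLin' (M j)), ?_, ?_, ?_⟩
  · rw [Finset.card_image_of_injective _ hinj, Finset.card_univ]
  · simp only [Finset.mem_image, Finset.mem_univ, true_and, forall_exists_index,
      forall_apply_eq_imp_iff]
    intro j
    have := finrank_range_toLin'_of_isIdempotent (hI j)
    rw [htr] at this
    exact_mod_cast this
  · simp only [Finset.mem_image, Finset.mem_univ, true_and, forall_exists_index,
      forall_apply_eq_imp_iff]
    intro j k hjk MP MQ hMP hMQ
    rw [hMP.unique (hP j), hMQ.unique (hP k)]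
    exact hd j k fun h => hjk (h ▸ rfl)

end Projections

section Pauli

/-- The nontrivial real character of `ZMod 2`. -/
def signChar (x : ZMod 2) : ℝ := if x = 0 then 1 else -1

lemma signChar_zero : signChar 0 = 1 := by simp [signChar]

lemma signChar_one : signChar 1 = -1 := by simp [signChar]

lemma signChar_add (x y : ZMod 2) : signChar (x + y) = signChar x * signChar y := by
  have h : ∀ z : ZMod 2, z = 0 ∨ z = 1 := by decide
  rcases h x with rfl | rfl <;> rcases h y with rfl | rfl <;>
    simp [signChar, CharTwo.add_self_eq_zero]

lemma signChar_mul_self (x : ZMod 2) : signChar x * signChar x = 1 := by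
  rw [← signChar_add, CharTwo.add_self_eq_zero, signChar_zero]

lemma one_add_signChar (x : ZMod 2) : 1 + signChar x = if x = 0 then 2 else 0 := by
  unfold signChar
  split_ifs <;> norm_num

variable {ι : Type*} [Fintype ι] [DecidableEq ι]

lemma sum_signChar_dotProduct (b : ι → ZMod 2) :
    ∑ u : ι → ZMod 2, signChar (b ⬝ᵥ u) = if b = 0 then 2 ^ Fintype.card ι else 0 := by
  split_ifs with hb
  · simp [hb, signChar_zero]
  · obtain ⟨j, hj⟩ := Function.ne_iff.mp hb
    have hj1 : b j = 1 := by
      have : ∀ x : ZMod 2, x ≠ 0 → x = 1 := by decide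
      exact this _ hj
    have h := Equiv.sum_comp (Equiv.addRight (Pi.single j 1 : ι → ZMod 2))
      fun u => signChar (b ⬝ᵥ u)
    simp only [Equiv.coe_addRight, dotProduct_add, dotProduct_single, mul_one, signChar_add, hj1,
      signChar_one, mul_neg, Finset.sum_neg_distrib] at h
    linarith

omit [Fintype ι] [DecidableEq ι] in
lemma add_add_cancel_right_zmod_two (u a : ι → ZMod 2) : u + a + a = u := by
  rw [add_assoc]
  exact funext fun j => by simp [CharTwo.add_self_eq_zero]

/-- The Pauli matrix `X(a) Z(b)`, up to sign, on functions on `(ZMod 2)^ι`. -/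
def pauli (a b : ι → ZMod 2) : Matrix (ι → ZMod 2) (ι → ZMod 2) ℝ :=
  fun u v => if v = u + a then signChar (b ⬝ᵥ u) else 0

omit [DecidableEq ι] in
lemma pauli_transpose {a b : ι → ZMod 2} (h : a ⬝ᵥ b = 0) : (pauli a b)ᵀ = pauli a b := by
  ext u v
  have hiff : u = v + a ↔ v = u + a := by
    constructor <;> rintro rfl <;> rw [add_add_cancel_right_zmod_two]
  simp only [pauli, Matrix.transpose_apply, hiff]
  split_ifs with hv
  · rw [hv, dotProduct_add, dotProduct_comm b a, h, add_zero]
  · rfl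

lemma pauli_mul_self {a b : ι → ZMod 2} (h : a ⬝ᵥ b = 0) : pauli a b * pauli a b = 1 := by
  ext u v
  simp only [pauli, Matrix.mul_apply, ite_mul, zero_mul, Finset.sum_ite_eq', Finset.mem_univ,
    if_true, Matrix.one_apply]
  rw [add_add_cancel_right_zmod_two, dotProduct_add, dotProduct_comm b a, h,
    add_zero]
  simp only [eq_comm (a := v), mul_ite, signChar_mul_self, mul_zero]

lemma sum_pauli_mul (p q : (ι → ZMod 2) × (ι → ZMod 2)) :
    ∑ u, ∑ v, pauli p.1 p.2 u v * pauli q.1 q.2 u v =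
      if p = q then 2 ^ Fintype.card ι else 0 := by
  obtain ⟨a, b⟩ := p
  obtain ⟨c, d⟩ := q
  simp only [pauli, ite_mul, zero_mul, Finset.sum_ite_eq', Finset.mem_univ,
    if_true, add_right_inj, mul_ite, mul_zero, ← signChar_add, ← add_dotProduct, Prod.mk.injEq]
  by_cases hac : a = c
  · have hbd : b + d = 0 ↔ b = d := by
      simp only [funext_iff, Pi.add_apply, Pi.zero_apply, CharTwo.add_eq_zero]
    simp only [hac, if_true, sum_signChar_dotProduct, true_and, hbd]
  · simp [hac, Ne.symm hac]

omit [DecidableEq ι] in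
lemma pauli_zero : pauli (0 : ι → ZMod 2) 0 = 1 := by
  ext u v
  simp [pauli, Matrix.one_apply, signChar_zero, eq_comm]

lemma trace_pauli {p : (ι → ZMod 2) × (ι → ZMod 2)} (hp : p ≠ 0) : (pauli p.1 p.2).trace = 0 := by
  have h := sum_pauli_mul p 0
  rw [if_neg hp] at h
  simpa [pauli_zero, Matrix.one_apply, Matrix.trace] using h

/-- Labels of the symmetric Pauli matrices other than the identity. -/
abbrev SymmPauliLabel (ι : Type*) [Fintype ι] [DecidableEq ι] :=
  {p : (ι → ZMod 2) × (ι → ZMod 2) // p.1 ⬝ᵥ p.2 = 0 ∧ p ≠ 0}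

lemma card_symmPauliLabel_mul_two :
    (Fintype.card (SymmPauliLabel ι) + 1) * 2 =
      2 ^ Fintype.card ι * (2 ^ Fintype.card ι + 1) := by
  have h1 : Fintype.card (SymmPauliLabel ι) + 1 =
      (Finset.univ.filter fun p : (ι → ZMod 2) × (ι → ZMod 2) => p.1 ⬝ᵥ p.2 = 0).card := by
    rw [Fintype.card_subtype, ← Finset.card_erase_add_one
      (s := Finset.univ.filter fun p : (ι → ZMod 2) × (ι → ZMod 2) => p.1 ⬝ᵥ p.2 = 0)
      (a := 0) (by simp)]
    refine congrArg (Finset.card · + 1) ?_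
    ext p
    simp [and_comm]
  have h2 : ∑ p : (ι → ZMod 2) × (ι → ZMod 2), (1 + signChar (p.1 ⬝ᵥ p.2)) =
      2 ^ Fintype.card ι * (2 ^ Fintype.card ι + 1) := by
    rw [Finset.sum_add_distrib, Fintype.sum_prod_type (fun p => signChar (p.1 ⬝ᵥ p.2))]
    simp [sum_signChar_dotProduct]
    ring
  simp only [one_add_signChar, ← Finset.sum_filter, Finset.sum_const, nsmul_eq_mul, ← h1] at h2
  exact_mod_cast h2

/-- The projection onto the `s`-eigenspace of a symmetric Pauli matrix. -/
noncomputable def pauliProj (j : SymmPauliLabel ι × ℤˣ) : Matrix (ι → ZMod 2) (ι → ZMod 2) ℝ :=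
  (1 / 2 : ℝ) • (1 + ((j.2 : ℤ) : ℝ) • pauli j.1.1.1 j.1.1.2)

lemma units_cast_sq (s : ℤˣ) : ((s : ℤ) : ℝ) * ((s : ℤ) : ℝ) = 1 := by
  rcases Int.units_eq_one_or s with rfl | rfl <;> norm_num

lemma pauliProj_transpose (j : SymmPauliLabel ι × ℤˣ) : (pauliProj j)ᵀ = pauliProj j := by
  simp [pauliProj, pauli_transpose j.1.2.1]

lemma pauliProj_mul_self (j : SymmPauliLabel ι × ℤˣ) :
    pauliProj j * pauliProj j = pauliProj j := by
  simp only [pauliProj, Matrix.smul_mul, Matrix.mul_smul, Matrix.mul_add, Matrix.add_mul,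
    Matrix.one_mul, Matrix.mul_one, pauli_mul_self j.1.2.1, smul_add, smul_smul,
    mul_mul_mul_comm _ ((j.2 : ℤ) : ℝ), units_cast_sq]
  module

lemma trace_pauliProj (j : SymmPauliLabel ι × ℤˣ) :
    (pauliProj j).trace = 2 ^ Fintype.card ι / 2 := by
  simp [pauliProj, Matrix.trace_smul, Matrix.trace_add, trace_pauli j.1.2.2]
  ring

lemma frobSq_pauliProj_sub (j k : SymmPauliLabel ι × ℤˣ) (hjk : j ≠ k) :
    (2 : ℝ) ^ Fintype.card ι / 4 ≤ 1 / 2 * frobSq (pauliProj j - pauliProj k) := by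
  obtain ⟨p, s⟩ := j
  obtain ⟨q, t⟩ := k
  have hexp : frobSq (pauliProj (p, s) - pauliProj (q, t)) =
      1 / 4 * (((s : ℤ) * (s : ℤ) : ℝ) * ∑ u, ∑ v, pauli p.1.1 p.1.2 u v * pauli p.1.1 p.1.2 u v
        + ((t : ℤ) * (t : ℤ) : ℝ) * ∑ u, ∑ v, pauli q.1.1 q.1.2 u v * pauli q.1.1 q.1.2 u v
        - 2 * ((s : ℤ) * (t : ℤ) : ℝ) *
          ∑ u, ∑ v, pauli p.1.1 p.1.2 u v * pauli q.1.1 q.1.2 u v) := by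
    simp only [frobSq, Finset.mul_sum, ← Finset.sum_add_distrib, ← Finset.sum_sub_distrib]
    refine Finset.sum_congr rfl fun u _ => Finset.sum_congr rfl fun v _ => ?_
    simp only [pauliProj, Matrix.sub_apply, Matrix.smul_apply, Matrix.add_apply, smul_eq_mul]
    ring
  rw [hexp, sum_pauli_mul, sum_pauli_mul, sum_pauli_mul, if_pos rfl, if_pos rfl,
    units_cast_sq, units_cast_sq]
  have hpos : (0 : ℝ) < 2 ^ Fintype.card ι := by positivity
  split_ifs with h
  · have hst : s ≠ t := fun hst => hjk (Prod.ext (Subtype.ext h) hst)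
    have hst' : ((s : ℤ) : ℝ) * ((t : ℤ) : ℝ) = -1 := by
      rcases Int.units_eq_one_or s with rfl | rfl <;> rcases Int.units_eq_one_or t with rfl | rfl
        <;> simp_all
    rw [hst']
    linarith
  · linarith

end Pauli

/-- for each `i ≥ 2` there is a packing of `(2^i − 1)(2^i + 2)`
    distinct `2^{i−1}`-dimensional subspaces of `ℝ^{2^i}` with pairwise squared
    chordal distance at least `2^{i−2}` (the orthoplex bound). -/
theorem stmt15 (i : ℕ) (hi : 2 ≤ i) :
    ∃ Pk : Finset (Submodule ℝ (Fin (2 ^ i) → ℝ)),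
      Pk.card = (2 ^ i - 1) * (2 ^ i + 2) ∧
      (∀ P ∈ Pk, Module.finrank ℝ P = 2 ^ (i - 1)) ∧
      (∀ P ∈ Pk, ∀ Q ∈ Pk, P ≠ Q →
        ∀ MP MQ : Matrix (Fin (2 ^ i)) (Fin (2 ^ i)) ℝ,
          IsProjOnto MP P → IsProjOnto MQ Q →
          (1 / 2 : ℝ) * frobSq (MP - MQ) ≥ (2 : ℝ) ^ (i - 2)) := by
  have e : Fin (2 ^ i) ≃ (Fin i → ZMod 2) := Fintype.equivOfCardEq (by simp)
  have hcard : Fintype.card (SymmPauliLabel (Fin i) × ℤˣ) = (2 ^ i - 1) * (2 ^ i + 2) := by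
    have h := card_symmPauliLabel_mul_two (ι := Fin i)
    rw [Fintype.card_fin] at h
    rw [Fintype.card_prod, Fintype.card_units_int]
    obtain ⟨m, hm⟩ : ∃ m, 2 ^ i = m + 1 := Nat.exists_eq_succ_of_ne_zero (by positivity)
    rw [hm] at h ⊢
    rw [Nat.add_sub_cancel]
    linarith
  rw [← hcard]
  refine exists_packing_of_projections (fun j => (pauliProj j).submatrix e e) _ _ (by positivity)
    (fun j => ?_) (fun j => ?_) (fun j => ?_) (fun j k hjk => ?_)
  · rw [Matrix.transpose_submatrix, pauliProj_transpose]
  · rw [Matrix.submatrix_mul_equiv, pauliProj_mul_self]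
  · have h : ((pauliProj j).submatrix e e).trace = (pauliProj j).trace :=
      e.sum_comp fun u => pauliProj j u u
    rw [h, trace_pauliProj, Fintype.card_fin]
    obtain ⟨k, rfl⟩ := Nat.exists_eq_add_of_le hi
    rw [show 2 + k - 1 = k + 1 by omega]
    push_cast
    ring
  · have h := frobSq_pauliProj_sub j k hjk
    rw [← frobSq_submatrix_equiv _ e, Matrix.submatrix_sub, Fintype.card_fin] at h
    refine le_of_eq_of_le ?_ h
    obtain ⟨k, rfl⟩ := Nat.exists_eq_add_of_le hi
    rw [Nat.add_sub_cancel_left]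
    ring
end

section
/- For every integer i ≥ 1 there exist Π_{j=1}^{i} (2^j + 2) pairwise distinct one-dimensional subspaces (lines) of ℝ^{2^i} such that any two distinct lines P, Q satisfy ½‖Π_P − Π_Q‖² ≥ 1/2; equivalently, any two of the lines meet at an angle of at least π/4 (unit vectors u ∈ P, v ∈ Q satisfy |⟨u, v⟩| ≤ 1/√2). -/
open Matrix BigOperators

/-- A family of orthonormal systems of vectors in `ℝ^n`, such that vectors from different systems
meet at an angle of at least `π/4`. -/
structure IsFramePacking {ι κ n : Type*} [Fintype n] (v : ι → κ → n → ℝ) : Prop where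
  unit : ∀ i x, v i x ⬝ᵥ v i x = 1
  orth : ∀ i x y, x ≠ y → v i x ⬝ᵥ v i y = 0
  sep : ∀ i j x y, i ≠ j → (v i x ⬝ᵥ v j y) ^ 2 ≤ 1 / 2

namespace IsFramePacking

variable {ι κ n : Type*} [Fintype n] {v : ι → κ → n → ℝ}

lemma sq_le_one (h : IsFramePacking v) (i j : ι) (x y : κ) : (v i x ⬝ᵥ v j y) ^ 2 ≤ 1 := by
  by_cases hij : i = j
  · subst hij
    by_cases hxy : x = y
    · subst hxy; simp [h.unit]
    · simp [h.orth i x y hxy]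
  · linarith [h.sep i j x y hij]

lemma reindex {ι' κ' n' : Type*} [Fintype n'] (h : IsFramePacking v)
    (e : ι' ≃ ι) (f : κ' ≃ κ) (g : n' ≃ n) :
    IsFramePacking (fun i x => v (e i) (f x) ∘ g) where
  unit i x := by simp [h.unit]
  orth i x y hxy := by simpa using h.orth _ _ _ (f.injective.ne hxy)
  sep i j x y hij := by simpa using h.sep _ _ _ _ (e.injective.ne hij)

/-- The sign `±1` attached to a Boolean. -/
def sign (s : Bool) : ℝ := if s then -1 else 1

/-- Each orthonormal system `F` of the family gives the orthonormal system of the vectors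
`(F x, 0)`, `(0, F x)` and, for every `g`, that of the vectors `(F x, ± F (x + g)) / √2`. -/
noncomputable def double [Add κ] (v : ι → κ → n → ℝ) :
    ι × Option κ → κ × Bool → n ⊕ n → ℝ
  | (i, none), (x, false) => Sum.elim (v i x) 0
  | (i, none), (x, true) => Sum.elim 0 (v i x)
  | (i, some g), (x, s) =>
      Sum.elim (√(1 / 2) • v i x) ((√(1 / 2) * sign s) • v i (x + g))

lemma sign_sq (s : Bool) : sign s ^ 2 = 1 := by
  cases s <;> simp [sign]

lemma double_some_dotProduct_some [Add κ] (v : ι → κ → n → ℝ) (i j : ι) (g h x y : κ)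
    (s t : Bool) :
    double v (i, some g) (x, s) ⬝ᵥ double v (j, some h) (y, t) =
      1 / 2 * (v i x ⬝ᵥ v j y + sign s * sign t * (v i (x + g) ⬝ᵥ v j (y + h))) := by
  have hr : √(1 / 2 : ℝ) * √(1 / 2) = 1 / 2 := Real.mul_self_sqrt (by norm_num)
  simp only [double, sumElim_dotProduct_sumElim, smul_dotProduct, dotProduct_smul, smul_eq_mul]
  linear_combination (v i x ⬝ᵥ v j y + sign s * sign t * (v i (x + g) ⬝ᵥ v j (y + h))) * hr

lemma double_none_dotProduct_some_sq [Add κ] (hv : IsFramePacking v) (i j : ι) (h x y : κ)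
    (s t : Bool) :
    (double v (i, none) (x, s) ⬝ᵥ double v (j, some h) (y, t)) ^ 2 ≤ 1 / 2 := by
  have hr : √(1 / 2 : ℝ) ^ 2 = 1 / 2 := Real.sq_sqrt (by norm_num)
  cases s <;>
    simp only [double, sumElim_dotProduct_sumElim, dotProduct_smul, smul_eq_mul, zero_dotProduct,
      mul_zero, add_zero, zero_add, mul_pow, hr, sign_sq]
  · linarith [hv.sq_le_one i j x y]
  · linarith [hv.sq_le_one i j x (y + h)]

lemma double_none_dotProduct_none [Add κ] (v : ι → κ → n → ℝ) (i j : ι) (x y : κ) (s t : Bool) :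
    double v (i, none) (x, s) ⬝ᵥ double v (j, none) (y, t) =
      if s = t then v i x ⬝ᵥ v j y else 0 := by
  cases s <;> cases t <;> simp [double]

lemma isFramePacking_double [AddGroup κ] (hv : IsFramePacking v) :
    IsFramePacking (double v) where
  unit := by
    rintro ⟨i, _ | g⟩ ⟨x, s⟩
    · simp [double_none_dotProduct_none, hv.unit]
    · rw [double_some_dotProduct_some, hv.unit, hv.unit]
      linear_combination (1 / 2 : ℝ) * sign_sq s
  orth := by
    rintro ⟨i, _ | g⟩ ⟨x, s⟩ ⟨y, t⟩ hne
    · rw [double_none_dotProduct_none]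
      split_ifs with hst
      · exact hv.orth i x y fun hxy => hne (by rw [hxy, hst])
      · rfl
    · rw [double_some_dotProduct_some]
      by_cases hxy : x = y
      · subst hxy
        rw [hv.unit, hv.unit]
        cases s <;> cases t <;> simp_all [sign]
      · rw [hv.orth i x y hxy, hv.orth i _ _ fun h => hxy (add_right_cancel h)]
        ring
  sep := by
    rintro ⟨i, _ | g⟩ ⟨j, _ | h⟩ ⟨x, s⟩ ⟨y, t⟩ hne
    · rw [double_none_dotProduct_none]
      split_ifs
      · exact hv.sep i j x y fun hij => hne (by rw [hij])
      · norm_num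
    · exact hv.double_none_dotProduct_some_sq i j h x y s t
    · rw [dotProduct_comm]
      exact hv.double_none_dotProduct_some_sq j i g y x t s
    · rw [double_some_dotProduct_some]
      have hst : (sign s * sign t) ^ 2 = 1 := by rw [mul_pow, sign_sq, sign_sq, mul_one]
      have hsum : (v i x ⬝ᵥ v j y) ^ 2 + (v i (x + g) ⬝ᵥ v j (y + h)) ^ 2 ≤ 1 := by
        by_cases hij : i = j
        · subst hij
          have hgh : g ≠ h := fun hgh => hne (by rw [hgh])
          by_cases hxy : x = y
          · subst hxy
            rw [hv.orth i (x + g) (x + h) fun h' => hgh (add_left_cancel h')]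
            simpa using hv.sq_le_one i i x x
          · rw [hv.orth i x y hxy]
            simpa using hv.sq_le_one i i (x + g) (y + h)
        · linarith [hv.sep i j x y hij, hv.sep i j (x + g) (y + h) hij]
      generalize v i x ⬝ᵥ v j y = p at *
      generalize v i (x + g) ⬝ᵥ v j (y + h) = q at *
      generalize sign s * sign t = c at *
      have hq : (c * q) ^ 2 = q ^ 2 := by rw [mul_pow, hst, one_mul]
      nlinarith [sq_nonneg (p - c * q)]

end IsFramePacking

/-- Repeated doubling of the standard basis of `ℝ^1`. -/
lemma exists_isFramePacking (i : ℕ) :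
    ∃ (m : ℕ) (v : Fin m → Fin (2 ^ i) → Fin (2 ^ i) → ℝ),
      m * 2 ^ i = ∏ j ∈ Finset.Icc 1 i, (2 ^ j + 2) ∧ IsFramePacking v := by
  induction i with
  | zero =>
    refine ⟨1, fun _ _ _ => 1, by simp, ⟨?_, ?_, ?_⟩⟩
    · intro i x
      simp [dotProduct]
    · intro i x y hxy
      exact absurd (Fin.ext (by omega)) hxy
    · intro i j x y hij
      exact absurd (Subsingleton.elim i j) hij
  | succ i ih =>
    obtain ⟨m, v, hm, hv⟩ := ih
    refine ⟨m * (2 ^ i + 1), _, ?_, hv.isFramePacking_double.reindex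
      (Fintype.equivOfCardEq (by simp)) (Fintype.equivOfCardEq (by simp [pow_succ]))
      (Fintype.equivOfCardEq (by simp [pow_succ, mul_two]))⟩
    rw [Finset.prod_Icc_succ_top (by omega), ← hm]
    ring

section Lines

variable {n : Type*} [Fintype n]

lemma IsProjOnto.eq_vecMulVec [DecidableEq n] {M : Matrix n n ℝ} {a : n → ℝ}
    (h : IsProjOnto M (ℝ ∙ a)) (ha : a ⬝ᵥ a = 1) : M = vecMulVec a a := by
  obtain ⟨hT, hI, hR⟩ := h
  have hMa : M *ᵥ a = a := by
    obtain ⟨w, hw⟩ : a ∈ LinearMap.range (toLin' M) := hR ▸ Submodule.mem_span_singleton_self a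
    rw [toLin'_apply] at hw
    rw [← hw, mulVec_mulVec, hI]
  refine ext_of_mulVec_single fun k => ?_
  set w : n → ℝ := Pi.single k 1
  obtain ⟨c, hc⟩ : ∃ c : ℝ, c • a = M *ᵥ w :=
    Submodule.mem_span_singleton.1 (hR ▸ LinearMap.mem_range_self (toLin' M) w)
  have hca : c = a ⬝ᵥ w := by
    calc c = a ⬝ᵥ (c • a) := by rw [dotProduct_smul, ha, smul_eq_mul, mul_one]
      _ = a ⬝ᵥ w := by rw [hc, dotProduct_mulVec, ← mulVec_transpose, hT, hMa]
  rw [← hc, hca, vecMulVec_mulVec]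
  ext u
  simp [mul_comm]

lemma frobSq_vecMulVec_sub_vecMulVec (a b : n → ℝ) :
    frobSq (vecMulVec a a - vecMulVec b b) =
      (a ⬝ᵥ a) ^ 2 - 2 * (a ⬝ᵥ b) ^ 2 + (b ⬝ᵥ b) ^ 2 := by
  simp only [frobSq, dotProduct, sq, Finset.sum_mul_sum, Matrix.sub_apply, vecMulVec_apply]
  simp only [Finset.mul_sum, ← Finset.sum_sub_distrib, ← Finset.sum_add_distrib]
  refine Finset.sum_congr rfl fun u _ => Finset.sum_congr rfl fun w _ => ?_
  ring

lemma abs_dotProduct_le_of_mem_span_singleton {a b u w : n → ℝ} (ha : a ⬝ᵥ a = 1)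
    (hb : b ⬝ᵥ b = 1) (hab : (a ⬝ᵥ b) ^ 2 ≤ 1 / 2) (hu : u ∈ ℝ ∙ a) (hw : w ∈ ℝ ∙ b)
    (huu : u ⬝ᵥ u = 1) (hww : w ⬝ᵥ w = 1) : |u ⬝ᵥ w| ≤ 1 / √2 := by
  obtain ⟨c, rfl⟩ := Submodule.mem_span_singleton.1 hu
  obtain ⟨d, rfl⟩ := Submodule.mem_span_singleton.1 hw
  simp only [smul_dotProduct, dotProduct_smul, smul_eq_mul, ha, hb, mul_one] at huu hww ⊢
  refine abs_le_of_sq_le_sq ?_ (by positivity)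
  calc (d * (c * (a ⬝ᵥ b))) ^ 2 = (c * c) * (d * d) * (a ⬝ᵥ b) ^ 2 := by ring
    _ ≤ 1 / 2 := by rw [huu, hww]; linarith
    _ = (1 / √2) ^ 2 := by rw [div_pow, Real.sq_sqrt (by norm_num), one_pow]

lemma span_singleton_ne_of_sq_dotProduct_le {a b : n → ℝ} (ha : a ⬝ᵥ a = 1) (hb : b ⬝ᵥ b = 1)
    (hab : (a ⬝ᵥ b) ^ 2 ≤ 1 / 2) : (ℝ ∙ a) ≠ ℝ ∙ b := by
  intro h
  obtain ⟨c, rfl⟩ :=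
    Submodule.mem_span_singleton.1 (h ▸ Submodule.mem_span_singleton_self a : a ∈ ℝ ∙ b)
  simp only [smul_dotProduct, dotProduct_smul, smul_eq_mul, hb, mul_one] at ha hab
  nlinarith

end Lines

/-- for each `i ≥ 1` there is a packing of `Π_{j=1}^{i} (2^j + 2)`
    distinct lines in `ℝ^{2^i}` with pairwise squared chordal distance at least `1/2`;
    equivalently any two of the lines meet at angle at least `π/4`. -/
theorem stmt16 (i : ℕ) (hi : 1 ≤ i) :
    ∃ Pk : Finset (Submodule ℝ (Fin (2 ^ i) → ℝ)),
      Pk.card = ∏ j ∈ Finset.Icc 1 i, (2 ^ j + 2) ∧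
      (∀ P ∈ Pk, Module.finrank ℝ P = 1) ∧
      (∀ P ∈ Pk, ∀ Q ∈ Pk, P ≠ Q →
        (∀ MP MQ : Matrix (Fin (2 ^ i)) (Fin (2 ^ i)) ℝ,
          IsProjOnto MP P → IsProjOnto MQ Q →
          (1 / 2 : ℝ) * frobSq (MP - MQ) ≥ 1 / 2) ∧
        (∀ u ∈ P, ∀ v ∈ Q, (∑ j, u j ^ 2) = 1 → (∑ j, v j ^ 2) = 1 →
          |∑ j, u j * v j| ≤ 1 / Real.sqrt 2)) := by
  classical
  obtain ⟨m, v, hm, hv⟩ := exists_isFramePacking i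
  let a : Fin m × Fin (2 ^ i) → Fin (2 ^ i) → ℝ := fun p => v p.1 p.2
  have ha : ∀ p, a p ⬝ᵥ a p = 1 := fun p => hv.unit p.1 p.2
  have hab : ∀ p q, p ≠ q → (a p ⬝ᵥ a q) ^ 2 ≤ 1 / 2 := by
    rintro ⟨k, x⟩ ⟨l, y⟩ hne
    by_cases hkl : k = l
    · subst hkl
      have h0 : a (k, x) ⬝ᵥ a (k, y) = 0 := hv.orth k x y fun hxy => hne (by rw [hxy])
      norm_num [h0]
    · exact hv.sep k l x y hkl
  have hinj : Function.Injective fun p => (ℝ ∙ a p) := fun p q hpq => by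
    by_contra hne
    exact span_singleton_ne_of_sq_dotProduct_le (ha p) (ha q) (hab p q hne) hpq
  refine ⟨Finset.univ.image fun p => (ℝ ∙ a p), ?_, ?_, ?_⟩
  · rw [Finset.card_image_of_injective _ hinj, ← hm]
    simp
  · simp only [Finset.mem_image, Finset.mem_univ, true_and]
    rintro _ ⟨p, rfl⟩
    refine finrank_span_singleton fun h0 => ?_
    simpa [h0] using ha p
  · simp only [Finset.mem_image, Finset.mem_univ, true_and]
    rintro _ ⟨p, rfl⟩ _ ⟨q, rfl⟩ hne
    have hpq := hab p q fun h => hne (by rw [h])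
    refine ⟨fun MP MQ hP hQ => ?_, fun u hu w hw huu hww => ?_⟩
    · rw [hP.eq_vecMulVec (ha p), hQ.eq_vecMulVec (ha q), frobSq_vecMulVec_sub_vecMulVec, ha, ha]
      linarith
    · refine abs_dotProduct_le_of_mem_span_singleton (ha p) (ha q) hpq hu hw ?_ ?_
      · simpa only [dotProduct, sq] using huu
      · simpa only [dotProduct, sq] using hww
end
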